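/- arXiv:1208.6032 — 2 statements merged into one kernel-verified Lean document; each statement's English description precedes it below -/
import Mathlib

section
/- Let f_0,…,f_m be monomials of degree d in R = k[x_0,…,x_n] satisfying the canonical restrictions, and suppose they define a birational map onto the image, i.e., k(f_0,…,f_m) = k(x_0^d, x_1/x_0, …, x_n/x_0) inside k(x_0,…,x_n). Let α_i = max_j (exponent of x_i in f_j), |α| = α_0+⋯+α_n, and f̂_j = x^α/f_j. Then k(f̂_0,…,f̂_m) = k(x_0^{|α|−d}, x_1/x_0, …, x_n/x_0). -/
open MvPolynomial

/-- The rational function field `k(x_0,…,x_n)`. -/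
abbrev RatFuncField (k : Type*) [Field k] (n : ℕ) : Type _ :=
  FractionRing (MvPolynomial (Fin (n + 1)) k)

/-- The variable `x_i` viewed inside `k(x_0,…,x_n)`. -/
noncomputable def xv {k : Type*} [Field k] {n : ℕ} (i : Fin (n + 1)) : RatFuncField k n :=
  algebraMap (MvPolynomial (Fin (n + 1)) k) (RatFuncField k n) (X i)

/-- Every exponent of a polynomial in monomials `x^{a_j}` is a combination of the `a_j`. -/
theorem exists_exponent_of_coeff_aeval_ne_zero {σ ι k : Type*} [Fintype ι] [Field k]
    (a : ι → σ →₀ ℕ) (p : MvPolynomial ι k) (c : σ →₀ ℕ)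
    (hc : coeff c (aeval (fun j => monomial (a j) (1 : k)) p) ≠ 0) :
    ∃ u : ι → ℕ, c = ∑ j, u j • a j := by
  classical
  induction p using MvPolynomial.induction_on generalizing c with
  | C r =>
    rw [aeval_C, algebraMap_eq, coeff_C] at hc
    refine ⟨0, ?_⟩
    by_contra h
    exact hc (if_neg fun h' => h (by simp [← h']))
  | add p q hp hq =>
    rw [map_add, coeff_add] at hc
    by_cases h : coeff c (aeval (fun j => monomial (a j) (1 : k)) p) = 0
    · exact hq c fun h' => hc (by rw [h, h', add_zero])
    · exact hp c h
  | mul_X p j hp =>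
    rw [map_mul, aeval_X, coeff_mul_monomial'] at hc
    split_ifs at hc with hle
    · rw [mul_one] at hc
      obtain ⟨u, hu⟩ := hp _ hc
      refine ⟨u + Pi.single j 1, ?_⟩
      simp only [Pi.add_apply, add_smul, Finset.sum_add_distrib, ← hu]
      simp [Pi.single_apply, ite_smul, tsub_add_cancel_of_le hle]
    · exact absurd rfl hc

theorem xv_ne_zero {k : Type*} [Field k] {n : ℕ} (i : Fin (n + 1)) :
    (xv i : RatFuncField k n) ≠ 0 := by
  unfold xv
  exact (map_ne_zero_iff _ (IsFractionRing.injective _ _)).2 (X_ne_zero i)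

/-- If `x_i / x_l` lies in the field generated by the monomials `x^{a_j}`, then `e_i - e_l` lies
in the lattice generated by the `a_j`. -/
theorem exists_exponents_of_div_mem_adjoin {k : Type*} [Field k] {n : ℕ} {ι : Type*} [Fintype ι]
    (a : ι → Fin (n + 1) → ℕ) (i l : Fin (n + 1))
    (h : (xv i : RatFuncField k n) / xv l ∈ IntermediateField.adjoin k
      (Set.range fun j => ∏ t, (xv t : RatFuncField k n) ^ a j t)) :
    ∃ u v : ι → ℕ, ∀ t, ∑ j, u j * a j t + (Pi.single i 1 : Fin (n + 1) → ℕ) t =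
      ∑ j, v j * a j t + (Pi.single l 1 : Fin (n + 1) → ℕ) t := by
  classical
  let b : ι → Fin (n + 1) →₀ ℕ := fun j => Finsupp.equivFunOnFinite.symm (a j)
  obtain ⟨r, s, hrs⟩ := (IntermediateField.mem_adjoin_range_iff k _ _).1 h
  have key : ∀ p : MvPolynomial ι k,
      aeval (fun j => ∏ t, (xv t : RatFuncField k n) ^ a j t) p =
        algebraMap (MvPolynomial (Fin (n + 1)) k) (RatFuncField k n)
          (aeval (fun j => monomial (b j) (1 : k)) p) := by
    intro p
    rw [← aeval_algebraMap_apply]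
    congr 2
    ext j
    rw [Function.comp_apply, monomial_eq, C_1, one_mul, Finsupp.prod_fintype _ _ (by simp), map_prod]
    simp [b, xv]
  rw [key, key] at hrs
  set R := aeval (fun j => monomial (b j) (1 : k)) r
  set S := aeval (fun j => monomial (b j) (1 : k)) s
  have hS0 : algebraMap (MvPolynomial (Fin (n + 1)) k) (RatFuncField k n) S ≠ 0 := by
    intro h0
    rw [h0, div_zero] at hrs
    exact div_ne_zero (xv_ne_zero i) (xv_ne_zero l) hrs
  have hpoly : S * X i = R * X l := by
    apply IsFractionRing.injective (MvPolynomial (Fin (n + 1)) k) (RatFuncField k n)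
    rw [div_eq_div_iff (xv_ne_zero l) hS0] at hrs
    rw [map_mul, map_mul, mul_comm]
    exact hrs
  obtain ⟨c, hc⟩ := ne_zero_iff.1 (fun h0 : S = 0 => hS0 (by rw [h0, map_zero]))
  have hc' : coeff (c + Finsupp.single i 1) (R * X l) ≠ 0 := by
    rwa [← hpoly, coeff_mul_X]
  rw [coeff_mul_X'] at hc'
  split_ifs at hc' with hl
  · obtain ⟨u, hu⟩ := exists_exponent_of_coeff_aeval_ne_zero b s c hc
    obtain ⟨v, hv⟩ := exists_exponent_of_coeff_aeval_ne_zero b r _ hc'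
    have hle : Finsupp.single l 1 ≤ c + Finsupp.single i 1 := by
      rw [Finsupp.single_le_iff]
      exact Nat.one_le_iff_ne_zero.2 (Finsupp.mem_support_iff.1 hl)
    have heq := (tsub_eq_iff_eq_add_of_le hle).1 hv
    rw [hu] at heq
    refine ⟨u, v, fun t => ?_⟩
    simpa [b, Finsupp.finsetSum_apply, Finsupp.single_eq_pi_single] using DFunLike.congr_fun heq t
  · exact absurd rfl hc'

/-- Dehomogenization of a monomial with respect to `x_0`. -/
theorem prod_xv_pow_eq {k : Type*} [Field k] {n : ℕ} (b : Fin (n + 1) → ℕ) :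
    ∏ i, (xv i : RatFuncField k n) ^ b i =
      xv 0 ^ (∑ i, b i) * ∏ i, ((xv i : RatFuncField k n) / xv 0) ^ b i := by
  rw [← Finset.prod_pow_eq_pow_sum, ← Finset.prod_mul_distrib]
  refine Finset.prod_congr rfl fun i _ => ?_
  rw [← mul_pow, mul_div_cancel₀ _ (xv_ne_zero 0)]

theorem prod_div_mem {k : Type*} [Field k] {n : ℕ}
    (K : IntermediateField k (RatFuncField k n))
    (hK : ∀ i : Fin n, (xv i.succ : RatFuncField k n) / xv 0 ∈ K) (b : Fin (n + 1) → ℕ) :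
    ∏ i, ((xv i : RatFuncField k n) / xv 0) ^ b i ∈ K := by
  refine prod_mem fun i _ => pow_mem ?_ _
  refine Fin.cases ?_ hK i
  rw [div_self (xv_ne_zero 0)]
  exact one_mem K

/-- A balanced exponent relation expressing `x_i / x_l` through the monomials `x^{a_j}` expresses
it through the dual monomials `x^{α - a_j}` as well. -/
theorem div_eq_prod_dual {k : Type*} [Field k] {n : ℕ} {ι : Type*} [Fintype ι]
    (a : ι → Fin (n + 1) → ℕ) (α : Fin (n + 1) → ℕ) (hle : ∀ j t, a j t ≤ α t)
    (i l : Fin (n + 1)) (u v : ι → ℕ)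
    (huv : ∀ t, ∑ j, u j * a j t + (Pi.single i 1 : Fin (n + 1) → ℕ) t =
      ∑ j, v j * a j t + (Pi.single l 1 : Fin (n + 1) → ℕ) t)
    (hsum : ∑ j, u j = ∑ j, v j) :
    (xv i : RatFuncField k n) / xv l =
      (∏ j, (∏ t, (xv t : RatFuncField k n) ^ (α t - a j t)) ^ u j) /
        ∏ j, (∏ t, (xv t : RatFuncField k n) ^ (α t - a j t)) ^ v j := by
  have hx := fun t => xv_ne_zero (k := k) (n := n) t
  have hprod : ∀ (w : ι → ℕ) (e : Fin (n + 1)),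
      (∏ j, (∏ t, (xv t : RatFuncField k n) ^ a j t) ^ w j) * xv e =
        ∏ t, (xv t : RatFuncField k n) ^
          (∑ j, w j * a j t + (Pi.single e 1 : Fin (n + 1) → ℕ) t) := by
    intro w e
    simp only [pow_add, Finset.prod_mul_distrib]
    congr 1
    · simp only [← Finset.prod_pow, ← Finset.prod_pow_eq_pow_sum]
      rw [Finset.prod_comm]
      simp only [← pow_mul, mul_comm]
    · simp [Pi.single_apply, pow_ite]
  have hrel : (∏ j, (∏ t, (xv t : RatFuncField k n) ^ a j t) ^ u j) * xv i =
      (∏ j, (∏ t, (xv t : RatFuncField k n) ^ a j t) ^ v j) * xv l := by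
    rw [hprod, hprod]
    simp only [huv]
  have hdual : ∀ w : ι → ℕ,
      (∏ j, (∏ t, (xv t : RatFuncField k n) ^ (α t - a j t)) ^ w j) *
        (∏ j, (∏ t, (xv t : RatFuncField k n) ^ a j t) ^ w j) =
        (∏ t, (xv t : RatFuncField k n) ^ α t) ^ (∑ j, w j) := by
    intro w
    rw [← Finset.prod_mul_distrib, ← Finset.prod_pow_eq_pow_sum]
    refine Finset.prod_congr rfl fun j _ => ?_
    rw [← mul_pow, ← Finset.prod_mul_distrib]
    simp only [← pow_add, tsub_add_cancel_of_le (hle j _)]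
  have hne : ∀ (c : ι → Fin (n + 1) → ℕ) (w : ι → ℕ),
      (∏ j, (∏ t, (xv t : RatFuncField k n) ^ c j t) ^ w j) ≠ 0 := fun c w =>
    Finset.prod_ne_zero_iff.2 fun j _ => pow_ne_zero _ <|
      Finset.prod_ne_zero_iff.2 fun t _ => pow_ne_zero _ (hx t)
  have hu := hdual u
  rw [hsum, ← hdual v] at hu
  rw [div_eq_div_iff (hx l) (hne (fun j t => α t - a j t) v)]
  apply mul_left_cancel₀ (hne a u)
  linear_combination
    (∏ j, (∏ t, (xv t : RatFuncField k n) ^ (α t - a j t)) ^ v j) * hrel - xv l * hu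

/-- if monomials `f_j = x^{a_j}` of degree `d` satisfying the canonical
restrictions define a birational map onto the image, i.e.
`k(f_0,…,f_m) = k(x_0^d, x_1/x_0, …, x_n/x_0)`, then the Newton complementary duals
`f̂_j = x^α/f_j` satisfy `k(f̂_0,…,f̂_m) = k(x_0^{|α|−d}, x_1/x_0, …, x_n/x_0)`. -/
theorem dual_monomials_birational
    {k : Type*} [Field k] {n m d : ℕ}
    (a : Fin (m + 1) → Fin (n + 1) → ℕ)
    (hdeg : ∀ j, ∑ i, a j i = d)
    (hnofix : ∀ i, ∃ j, a j i = 0)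
    (hall : ∀ i, ∃ j, a j i ≠ 0)
    (α : Fin (n + 1) → ℕ) (hα : ∀ i, α i = Finset.univ.sup fun j => a j i)
    (hbir : IntermediateField.adjoin k
        (Set.range fun j => ∏ i, (xv i : RatFuncField k n) ^ a j i) =
      IntermediateField.adjoin k
        (insert ((xv 0 : RatFuncField k n) ^ d)
          (Set.range fun i : Fin n => (xv i.succ : RatFuncField k n) / xv 0))) :
    IntermediateField.adjoin k
        (Set.range fun j => ∏ i, (xv i : RatFuncField k n) ^ (α i - a j i)) =
      IntermediateField.adjoin k
        (insert ((xv 0 : RatFuncField k n) ^ ((∑ i, α i) - d))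
          (Set.range fun i : Fin n => (xv i.succ : RatFuncField k n) / xv 0)) := by
  have hle : ∀ j t, a j t ≤ α t := fun j t => by
    rw [hα]
    exact Finset.le_sup (f := fun j => a j t) (Finset.mem_univ j)
  have hd : 0 < d := by
    obtain ⟨j, hj⟩ := hall 0
    rw [← hdeg j]
    exact lt_of_lt_of_le (Nat.pos_of_ne_zero hj)
      (Finset.single_le_sum (fun _ _ => Nat.zero_le _) (Finset.mem_univ 0))
  have hdual_deg : ∀ j, ∑ i, (α i - a j i) = ∑ i, α i - d := fun j => by
    rw [Finset.sum_tsub_distrib _ fun i _ => hle j i, hdeg]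
  apply le_antisymm
  · rw [IntermediateField.adjoin_le_iff]
    rintro _ ⟨j, rfl⟩
    simp only [SetLike.mem_coe]
    rw [prod_xv_pow_eq, hdual_deg]
    exact mul_mem (IntermediateField.subset_adjoin _ _ (Set.mem_insert _ _))
      (prod_div_mem _ (fun i => IntermediateField.subset_adjoin _ _
        (Set.mem_insert_of_mem _ (Set.mem_range_self i))) _)
  · set K := IntermediateField.adjoin k
      (Set.range fun j => ∏ i, (xv i : RatFuncField k n) ^ (α i - a j i))
    have hmem : ∀ j, ∏ i, (xv i : RatFuncField k n) ^ (α i - a j i) ∈ K := fun j =>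
      IntermediateField.subset_adjoin k _ (Set.mem_range_self j)
    have hK : ∀ i : Fin n, (xv i.succ : RatFuncField k n) / xv 0 ∈ K := by
      intro i
      obtain ⟨u, v, huv⟩ := exists_exponents_of_div_mem_adjoin (k := k) a i.succ 0 (by
        rw [hbir]
        exact IntermediateField.subset_adjoin _ _ (Set.mem_insert_of_mem _ ⟨i, rfl⟩))
      have hsum : ∑ j, u j = ∑ j, v j := by
        have hdegree : ∀ w : Fin (m + 1) → ℕ, ∑ t, ∑ j, w j * a j t = (∑ j, w j) * d := by
          intro w
          rw [Finset.sum_comm, Finset.sum_mul]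
          simp only [← Finset.mul_sum, hdeg]
        have htotal := Finset.sum_congr (rfl : Finset.univ = Finset.univ) fun t _ => huv t
        rw [Finset.sum_add_distrib, Finset.sum_add_distrib, hdegree, hdegree,
          Finset.sum_pi_single', Finset.sum_pi_single'] at htotal
        simpa [hd.ne'] using htotal
      rw [div_eq_prod_dual a α hle i.succ 0 u v huv hsum]
      exact div_mem (prod_mem fun j _ => pow_mem (hmem j) _)
        (prod_mem fun j _ => pow_mem (hmem j) _)
    rw [IntermediateField.adjoin_le_iff]
    rintro _ (rfl | ⟨i, rfl⟩)
    · have hpow := prod_xv_pow_eq (k := k) fun i => α i - a 0 i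
      rw [hdual_deg] at hpow
      have hne : ∏ i, ((xv i : RatFuncField k n) / xv 0) ^ (α i - a 0 i) ≠ 0 :=
        Finset.prod_ne_zero_iff.2 fun i _ =>
          pow_ne_zero _ (div_ne_zero (xv_ne_zero i) (xv_ne_zero 0))
      rw [SetLike.mem_coe, eq_div_of_mul_eq hne hpow.symm]
      exact div_mem (hmem 0) (prod_div_mem K hK _)
    · exact hK i
end

section
/- Let R be a Noetherian commutative ring, I ⊆ R an ideal, g_d ∈ I, and g_{d-1} ∈ R an element not contained in any minimal prime of I of minimal height. Then in R[x_n], the ideal (I, g_{d-1}·x_n + g_d) has height equal to height(I) + 1. -/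
/-- The height of an ideal: the infimum of the heights of the primes containing it. -/
noncomputable def idealHeight {R : Type*} [CommRing R] (I : Ideal R) : ℕ∞ :=
  ⨅ p : {p : PrimeSpectrum R // I ≤ p.asIdeal}, Order.height p.1

/-- The grade (depth) of an ideal on `R`: the supremum of the lengths of regular sequences
contained in it. -/
noncomputable def idealGrade {R : Type*} [CommRing R] (I : Ideal R) : ℕ∞ :=
  ⨆ rs : {rs : List R // (∀ r ∈ rs, r ∈ I) ∧ RingTheory.Sequence.IsRegular R rs},
    (rs.1.length : ℕ∞)

/-- A (Noetherian) ring is Cohen–Macaulay iff `grade I = height I` for every proper ideal. -/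
def IsCohenMacaulayRing (R : Type*) [CommRing R] : Prop :=
  ∀ I : Ideal R, I ≠ ⊤ → idealGrade I = idealHeight I

/-- An ideal `I` is perfect of codimension 2 if it has height 2 and `R/I` admits a finite
free resolution `0 → F₁ → F₀ → R → R/I → 0`. -/
def IsPerfectCodimTwo {R : Type*} [CommRing R] (I : Ideal R) : Prop :=
  idealHeight I = 2 ∧
    ∃ (a b : ℕ) (φ : (Fin b → R) →ₗ[R] (Fin a → R)) (ψ : (Fin a → R) →ₗ[R] R),
      Function.Injective φ ∧ LinearMap.range φ = LinearMap.ker ψ ∧ LinearMap.range ψ = I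

open Polynomial in
/-- If `Q` is a prime of `R[X]` lying over `p`, then `ht p ≤ ht Q`. -/
lemma Polynomial.height_under_le {R : Type*} [CommRing R] [IsNoetherianRing R]
    (p : Ideal R) [p.IsPrime] (Q : Ideal R[X]) [Q.IsPrime] [Q.LiesOver p] :
    p.height ≤ Q.height := by
  rw [Ideal.height_eq_height_add_of_liesOver_of_hasGoingDown p Q]
  exact le_self_add

open Polynomial in
lemma Polynomial.liesOver_map_C {R : Type*} [CommRing R] (p : Ideal R) :
    (p.map (C : R →+* R[X])).LiesOver p := by
  refine ⟨Ideal.ext fun r => ?_⟩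
  rw [Ideal.under_def, Ideal.mem_comap, algebraMap_eq, Ideal.mem_map_C_iff]
  refine ⟨fun h n => ?_, fun h => by simpa using h 0⟩
  rw [coeff_C]
  split_ifs
  exacts [h, p.zero_mem]

open Polynomial in
/-- A prime of `R[X]` that lies over `p` and contains `X` has height at least `ht p + 1`. -/
lemma Polynomial.height_add_one_le_of_X_mem {R : Type*} [CommRing R] [IsNoetherianRing R]
    (p : Ideal R) [p.IsPrime] (Q : Ideal R[X]) [Q.IsPrime] [Q.LiesOver p] (hX : X ∈ Q) :
    p.height + 1 ≤ Q.height := by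
  have hprime : (p.map (C : R →+* R[X])).IsPrime := Ideal.isPrime_map_C_of_isPrime
  have hover := liesOver_map_C p
  have hle : p.map (C : R →+* R[X]) ≤ Q :=
    Ideal.map_le_iff_le_comap.mpr (Ideal.LiesOver.over (p := p) (P := Q)).le
  have hlt : p.map (C : R →+* R[X]) < Q := by
    refine lt_of_le_of_ne hle fun h => ?_
    rw [← h, Ideal.mem_map_C_iff] at hX
    exact (Ideal.ne_top_iff_one p).mp Ideal.IsPrime.ne_top' (by simpa using hX 1)
  exact (add_le_add_left (height_under_le p _) 1).trans
    (Ideal.height_add_one_le_of_lt_of_isPrime hlt)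

open Polynomial in
/-- The prime `(p, X)` of `R[X]` has height at most `ht p + 1`. -/
lemma Polynomial.height_comap_constantCoeff_le {R : Type*} [CommRing R] [IsNoetherianRing R]
    (p : Ideal R) [p.IsPrime] :
    (p.comap (constantCoeff : R[X] →+* R)).height ≤ p.height + 1 := by
  set Q := p.comap (constantCoeff : R[X] →+* R) with hQ
  have hprime : Q.IsPrime := Ideal.comap_isPrime _ _
  have hover : Q.LiesOver p := ⟨Ideal.ext fun r => by simp [hQ, Ideal.under_def]⟩
  refine (Ideal.height_le_height_add_of_liesOver p Q).trans (add_le_add_right ?_ _)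
  have hle : p.map (algebraMap R R[X]) ≤ Q :=
    Ideal.map_le_iff_le_comap.mpr (Ideal.LiesOver.over (p := p) (P := Q)).le
  have hX : (X : R[X]) ∈ Q := by simp [hQ]
  have hspan : Q.map (Ideal.Quotient.mk (p.map (algebraMap R R[X]))) =
      Ideal.span {Ideal.Quotient.mk (p.map (algebraMap R R[X])) X} := by
    refine le_antisymm (Ideal.map_le_iff_le_comap.mpr fun f hf => ?_) ?_
    · have hf0 : Ideal.Quotient.mk (p.map (algebraMap R R[X])) (C (f.coeff 0)) = 0 :=
        Ideal.Quotient.eq_zero_iff_mem.mpr (Ideal.mem_map_of_mem _ hf)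
      rw [Ideal.mem_comap, ← X_mul_divX_add f, map_add, hf0, add_zero, map_mul]
      exact Ideal.mul_mem_right _ _ (Ideal.mem_span_singleton_self _)
    · rw [Ideal.span_singleton_le_iff_mem]
      exact Ideal.mem_map_of_mem _ hX
  rw [hspan]
  refine Ideal.height_span_singleton_le_one fun hunit =>
    (Ideal.ne_top_iff_one Q).mp hprime.ne_top ((Ideal.mem_quotient_iff_mem hle).mp ?_)
  rw [hspan, Ideal.span_singleton_eq_top.mpr hunit]
  exact Submodule.mem_top

lemma idealHeight_eq_height {R : Type*} [CommRing R] (I : Ideal R) :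
    idealHeight I = I.height := by
  apply le_antisymm
  · rw [Ideal.height_eq_inf_minimalPrimes]
    refine le_iInf₂ fun J hJ => ?_
    have := hJ.isPrime
    let p : {p : PrimeSpectrum R // I ≤ p.asIdeal} := ⟨⟨J, this⟩, hJ.le⟩
    exact (iInf_le _ p).trans_eq (PrimeSpectrum.height_eq_orderHeight p.1).symm
  · refine le_iInf fun p => ?_
    rw [← PrimeSpectrum.height_eq_orderHeight]
    exact Ideal.height_mono p.2

/-- if `g_d ∈ I` and `g_{d-1}` avoids every minimal prime of `I` of minimal
height, then the ideal `(I, g_{d-1}·x_n + g_d)` of `R[x_n]` has height `height(I) + 1`. -/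
theorem height_of_monoid_extension
    {R : Type*} [CommRing R] [IsNoetherianRing R] (I : Ideal R) (gd1 gd : R)
    (hgd : gd ∈ I)
    (hgd1 : ∀ p : PrimeSpectrum R, p.asIdeal ∈ I.minimalPrimes →
      Order.height p = idealHeight I → gd1 ∉ p.asIdeal) :
    idealHeight (I.map (Polynomial.C : R →+* Polynomial R) ⊔
        Ideal.span {Polynomial.C gd1 * Polynomial.X + Polynomial.C gd}) =
      idealHeight I + 1 := by
  set J := I.map (Polynomial.C : R →+* Polynomial R) ⊔
    Ideal.span {Polynomial.C gd1 * Polynomial.X + Polynomial.C gd} with hJ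
  apply le_antisymm
  · rw [show idealHeight I + 1 = ⨅ p : {p : PrimeSpectrum R // I ≤ p.asIdeal},
      (Order.height p.1 + 1) from ENat.iInf_add]
    refine le_iInf fun ⟨p, hp⟩ => ?_
    rw [idealHeight_eq_height, ← PrimeSpectrum.height_eq_orderHeight]
    refine (Ideal.height_mono ?_).trans (Polynomial.height_comap_constantCoeff_le p.asIdeal)
    rw [hJ, sup_le_iff, Ideal.map_le_iff_le_comap, Ideal.span_singleton_le_iff_mem]
    exact ⟨fun r hr => by simpa using hp hr, by simpa using hp hgd⟩
  · refine le_iInf fun ⟨Q, hQ⟩ => ?_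
    rw [← PrimeSpectrum.height_eq_orderHeight]
    obtain ⟨hIQ, hgQ⟩ := sup_le_iff.mp hQ
    rw [Ideal.map_le_iff_le_comap] at hIQ
    rw [Ideal.span_singleton_le_iff_mem] at hgQ
    let p : PrimeSpectrum R := PrimeSpectrum.comap Polynomial.C Q
    have hover : Q.asIdeal.LiesOver p.asIdeal := ⟨rfl⟩
    have hIp : I ≤ p.asIdeal := hIQ
    rw [idealHeight_eq_height] at hgd1 ⊢
    rcases (Ideal.height_mono hIp).lt_or_eq with hlt | heq
    · exact (Order.add_one_le_of_lt hlt).trans (Polynomial.height_under_le p.asIdeal Q.asIdeal)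
    · have hgp : gd1 ∉ p.asIdeal :=
        hgd1 p (Ideal.mem_minimalPrimes_of_height_le hIp heq.ge)
          ((PrimeSpectrum.height_eq_orderHeight p).symm.trans heq.symm)
      have hmul : Polynomial.C gd1 * Polynomial.X ∈ Q.asIdeal :=
        (Ideal.add_mem_iff_left _ (Ideal.mem_comap.mp (hIQ hgd))).mp hgQ
      rw [heq]
      exact Polynomial.height_add_one_le_of_X_mem p.asIdeal Q.asIdeal
        ((Q.isPrime.mem_or_mem hmul).resolve_left hgp)
end
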